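/- Let Θ_n(z) = z · h_n^{(1)'}(z)/h_n^{(1)}(z) where h_n^{(1)} is the spherical Hankel function of the first kind. Then for all z > 0 and all nonnegative integers n, Re Θ_n(z) ≤ -1/2 and Im Θ_n(z) > 0. -/

import Mathlib

open Real MeasureTheory intervalIntegral Filter Topology

/-- The Bessel function of the first kind, defined by its power series
(`t^ν` interpreted via `Real.rpow`, valid for `t > 0`). -/
noncomputable def besselJ (ν : ℝ) (t : ℝ) : ℝ :=
  ∑' k : ℕ, ((-1 : ℝ) ^ k / (k.factorial * Real.Gamma (k + ν + 1))) *
    (t / 2) ^ (2 * (k : ℝ) + ν)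

/-- The spherical Bessel function of the first kind `j_n(t) = √(π/(2t)) J_{n+1/2}(t)`. -/
noncomputable def sphJ (n : ℕ) (t : ℝ) : ℝ :=
  Real.sqrt (Real.pi / (2 * t)) * besselJ ((n : ℝ) + 1 / 2) t

/-- The spherical Bessel function of the second kind
`y_n(t) = √(π/(2t)) Y_{n+1/2}(t) = (-1)^{n+1} √(π/(2t)) J_{-(n+1/2)}(t)`. -/
noncomputable def sphY (n : ℕ) (t : ℝ) : ℝ :=
  (-1 : ℝ) ^ (n + 1) * Real.sqrt (Real.pi / (2 * t)) * besselJ (-((n : ℝ) + 1 / 2)) t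

/-- The spherical Hankel function of the first kind `h_n^{(1)} = j_n + i y_n`. -/
noncomputable def sphH1 (n : ℕ) (t : ℝ) : ℂ := (sphJ n t : ℂ) + Complex.I * (sphY n t : ℂ)

/-- The spherical Hankel function of the second kind `h_n^{(2)} = j_n - i y_n`. -/
noncomputable def sphH2 (n : ℕ) (t : ℝ) : ℂ := (sphJ n t : ℂ) - Complex.I * (sphY n t : ℂ)

/-- `Θ_n(z) = z h_n^{(1)'}(z) / h_n^{(1)}(z)`. -/
noncomputable def Theta (n : ℕ) (z : ℝ) : ℂ := (z : ℂ) * deriv (sphH1 n) z / sphH1 n z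

/-- Solutions of the three-term recurrence `u_{k+2} = (2k+1)/t u_{k+1} - u_k` satisfied by the
Riccati-Bessel functions, with prescribed first two members. -/
noncomputable def riccati (f g : ℝ → ℝ) : ℕ → ℝ → ℝ
  | 0, t => f t
  | 1, t => g t
  | k + 2, t => (2 * k + 1) / t * riccati f g (k + 1) t - riccati f g k t

lemma riccati_add_two (f g : ℝ → ℝ) (k : ℕ) (t : ℝ) :
    riccati f g (k + 2) t = (2 * k + 1) / t * riccati f g (k + 1) t - riccati f g k t := by
  rw [riccati]

lemma hasDerivAt_riccati {f g : ℝ → ℝ} (hf : ∀ t, HasDerivAt f (-g t) t)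
    (hg : ∀ t, HasDerivAt g (f t) t) {t : ℝ} (ht : 0 < t) (k : ℕ) :
    HasDerivAt (riccati f g k) (k / t * riccati f g k t - riccati f g (k + 1) t) t ∧
    HasDerivAt (riccati f g (k + 1))
      (riccati f g k t - k / t * riccati f g (k + 1) t) t := by
  induction k with
  | zero =>
    have h0 : riccati f g 0 = f := by funext t; rw [riccati]
    have h1 : riccati f g (0 + 1) = g := by funext t; rw [riccati]
    rw [h0, h1]
    exact ⟨by simpa using hf t, by simpa using hg t⟩
  | succ k ih =>
    obtain ⟨h0, h1⟩ := ih
    have hinv : HasDerivAt (fun t : ℝ => (2 * (k : ℝ) + 1) / t)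
        (-(2 * (k : ℝ) + 1) / t ^ 2) t := by
      refine ((hasDerivAt_inv ht.ne').const_mul (2 * (k : ℝ) + 1)).congr_deriv ?_
      ring
    refine ⟨?_, ?_⟩
    · refine h1.congr_deriv ?_
      rw [riccati_add_two]
      push_cast
      ring
    · have h2 := (hinv.mul h1).sub h0
      have he : riccati f g (k + 1 + 1) =
          (fun t : ℝ => (2 * (k : ℝ) + 1) / t) * riccati f g (k + 1) - riccati f g k := by
        funext s
        exact riccati_add_two f g k s
      rw [he]
      refine h2.congr_deriv ?_
      simp only [Pi.sub_apply, Pi.mul_apply]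
      push_cast
      field_simp
      ring

/-- The general term of the series defining `besselJ`. -/
noncomputable def besselTerm (ν t : ℝ) (k : ℕ) : ℝ :=
  ((-1 : ℝ) ^ k / (k.factorial * Real.Gamma (k + ν + 1))) * (t / 2) ^ (2 * (k : ℝ) + ν)

lemma besselTerm_succ_recurrence {ν t : ℝ} (hν : ∀ m : ℤ, ν ≠ m) (ht : 0 < t) (k : ℕ) :
    2 * ν / t * besselTerm ν t (k + 1) - besselTerm (ν - 1) t (k + 1) =
      besselTerm (ν + 1) t k := by
  have hx : 0 < t / 2 := by positivity
  have hne : (k : ℝ) + 1 + ν ≠ 0 := fun h => hν (-(k + 1)) (by push_cast; linarith)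
  have hΓ : Real.Gamma ((k : ℝ) + 1 + ν) ≠ 0 := by
    refine Real.Gamma_ne_zero fun m h => hν (-(m + k + 1)) (by push_cast; linarith)
  have e1 : (t / 2) ^ (2 * ((k : ℝ) + 1) + ν) =
      (t / 2) ^ (2 * (k : ℝ) + (ν + 1)) * (t / 2) := by
    rw [← Real.rpow_add_one hx.ne']; ring_nf
  have e2 : 2 * ((k : ℝ) + 1) + (ν - 1) = 2 * (k : ℝ) + (ν + 1) := by ring
  have g1 : Real.Gamma ((k : ℝ) + 1 + ν + 1) = (k + 1 + ν) * Real.Gamma (k + 1 + ν) :=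
    Real.Gamma_add_one hne
  have g2 : (k : ℝ) + (ν + 1) + 1 = k + 1 + ν + 1 := by ring
  have g3 : (k : ℝ) + 1 + (ν - 1) + 1 = k + 1 + ν := by ring
  simp only [besselTerm, Nat.cast_add, Nat.cast_one, Nat.factorial_succ, Nat.cast_mul, e1, e2,
    g2, g3, g1, pow_succ]
  have hk : ((k.factorial : ℕ) : ℝ) ≠ 0 := by positivity
  have hk1 : (k : ℝ) + 1 ≠ 0 := by positivity
  generalize (t / 2) ^ (2 * (k : ℝ) + (ν + 1)) = X
  field_simp
  ring

lemma besselTerm_zero_recurrence {ν t : ℝ} (hν : ∀ m : ℤ, ν ≠ m) (ht : 0 < t) :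
    2 * ν / t * besselTerm ν t 0 = besselTerm (ν - 1) t 0 := by
  have hx : 0 < t / 2 := by positivity
  have hne : ν ≠ 0 := fun h => hν 0 (by simpa using h)
  have hΓ : Real.Gamma ν ≠ 0 := by
    refine Real.Gamma_ne_zero fun m h => hν (-m) (by push_cast; linarith)
  have e1 : (t / 2) ^ ν = (t / 2) ^ (ν - 1) * (t / 2) := by
    rw [← Real.rpow_add_one hx.ne']; ring_nf
  simp only [besselTerm, Nat.cast_zero, mul_zero, zero_add, sub_add_cancel, e1,
    Real.Gamma_add_one hne]
  generalize (t / 2) ^ (ν - 1) = X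
  simp only [Nat.factorial_zero, Nat.cast_one, pow_zero]
  field_simp

lemma hasSum_besselTerm_add_one {ν t A B : ℝ} (hν : ∀ m : ℤ, ν ≠ m) (ht : 0 < t)
    (hA : HasSum (besselTerm ν t) A) (hB : HasSum (besselTerm (ν - 1) t) B) :
    HasSum (besselTerm (ν + 1) t) (2 * ν / t * A - B) := by
  have h := (hasSum_nat_add_iff' 1).2 ((hA.mul_left (2 * ν / t)).sub hB)
  simpa [besselTerm_succ_recurrence hν ht, besselTerm_zero_recurrence hν ht] using h

lemma hasSum_besselTerm_sub_one {ν t A B : ℝ} (hν : ∀ m : ℤ, ν ≠ m) (ht : 0 < t)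
    (hA : HasSum (besselTerm ν t) A) (hB : HasSum (besselTerm (ν + 1) t) B) :
    HasSum (besselTerm (ν - 1) t) (2 * ν / t * A - B) := by
  rw [← hasSum_nat_add_iff' 1]
  have hA' := (hasSum_nat_add_iff' 1).2 (hA.mul_left (2 * ν / t))
  convert hA'.sub hB using 1
  · funext k
    rw [← besselTerm_succ_recurrence hν ht]
    ring
  · simp [besselTerm_zero_recurrence hν ht]
    ring

lemma hasSum_besselTerm_half {t : ℝ} (ht : 0 < t) :
    HasSum (besselTerm (1 / 2) t) ((t / 2) ^ (-1 / 2 : ℝ) / √Real.pi * Real.sin t) := by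
  have hx : 0 < t / 2 := by positivity
  refine ((Real.hasSum_sin t).mul_left _).congr_fun ?_
  intro k
  have hG := Real.Gamma_mul_Gamma_add_half ((k : ℝ) + 1)
  rw [Real.Gamma_nat_eq_factorial, show 2 * ((k : ℝ) + 1) = ((2 * k + 1 : ℕ) : ℝ) + 1 by
    push_cast; ring, Real.Gamma_nat_eq_factorial] at hG
  have h2 : (2 : ℝ) ^ (1 - (((2 * k + 1 : ℕ) : ℝ) + 1)) = ((2 : ℝ) ^ (2 * k + 1))⁻¹ := by
    rw [← Real.rpow_natCast, ← Real.rpow_neg (by norm_num)]; ring_nf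
  have e : (t / 2) ^ (2 * (k : ℝ) + 1 / 2) =
      (t / 2) ^ (2 * k + 1) * (t / 2) ^ (-1 / 2 : ℝ) := by
    rw [← Real.rpow_natCast, ← Real.rpow_add hx]; push_cast; ring_nf
  rw [h2] at hG
  rw [besselTerm, e, show (k : ℝ) + 1 / 2 + 1 = k + 1 + 1 / 2 by ring, hG, div_pow]
  have : √Real.pi ≠ 0 := by positivity
  field_simp

lemma hasSum_besselTerm_neg_half {t : ℝ} (ht : 0 < t) :
    HasSum (besselTerm (-1 / 2) t) ((t / 2) ^ (-1 / 2 : ℝ) / √Real.pi * Real.cos t) := by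
  have hx : 0 < t / 2 := by positivity
  refine ((Real.hasSum_cos t).mul_left _).congr_fun ?_
  intro k
  have hG := Real.Gamma_mul_Gamma_add_half ((k : ℝ) + 1 / 2)
  rw [show (k : ℝ) + 1 / 2 + 1 / 2 = k + 1 by ring, Real.Gamma_nat_eq_factorial,
    show 2 * ((k : ℝ) + 1 / 2) = ((2 * k : ℕ) : ℝ) + 1 by
    push_cast; ring, Real.Gamma_nat_eq_factorial] at hG
  have h2 : (2 : ℝ) ^ (1 - (((2 * k : ℕ) : ℝ) + 1)) = ((2 : ℝ) ^ (2 * k))⁻¹ := by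
    rw [← Real.rpow_natCast, ← Real.rpow_neg (by norm_num)]; ring_nf
  have e : (t / 2) ^ (2 * (k : ℝ) + -1 / 2) =
      (t / 2) ^ (2 * k) * (t / 2) ^ (-1 / 2 : ℝ) := by
    rw [← Real.rpow_natCast, ← Real.rpow_add hx]; push_cast; ring_nf
  rw [h2, mul_comm] at hG
  rw [besselTerm, e, show (k : ℝ) + -1 / 2 + 1 = k + 1 / 2 by ring, hG, div_pow]
  have : √Real.pi ≠ 0 := by positivity
  field_simp

lemma nat_add_half_ne_int (n : ℕ) (m : ℤ) : (n : ℝ) + 1 / 2 ≠ m := by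
  intro h
  have : (2 * n + 1 : ℤ) = 2 * m := by
    have : (2 * n + 1 : ℝ) = 2 * m := by linarith
    exact_mod_cast this
  omega

lemma hasSum_besselTerm_nat_add_half {t : ℝ} (ht : 0 < t) (n : ℕ) :
    HasSum (besselTerm ((n : ℝ) + 1 / 2 - 1) t)
      ((t / 2) ^ (-1 / 2 : ℝ) / √Real.pi * riccati Real.cos Real.sin n t) ∧
    HasSum (besselTerm ((n : ℝ) + 1 / 2) t)
      ((t / 2) ^ (-1 / 2 : ℝ) / √Real.pi * riccati Real.cos Real.sin (n + 1) t) := by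
  induction n with
  | zero =>
    constructor
    · convert hasSum_besselTerm_neg_half ht using 2
      · norm_num
      · rw [riccati]
    · convert hasSum_besselTerm_half ht using 2
      · norm_num
      · rw [riccati]
  | succ n ih =>
    refine ⟨?_, ?_⟩
    · convert ih.2 using 2
      push_cast; ring
    · convert hasSum_besselTerm_add_one (nat_add_half_ne_int n) ht ih.2 ih.1 using 1
      · congr 1; push_cast; ring
      · rw [riccati_add_two]; ring

lemma hasSum_besselTerm_neg_nat_add_half {t : ℝ} (ht : 0 < t) (n : ℕ) :
    HasSum (besselTerm (-((n : ℝ) + 1 / 2) + 1) t)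
      ((t / 2) ^ (-1 / 2 : ℝ) / √Real.pi * ((-1) ^ n * riccati Real.sin (-Real.cos) n t)) ∧
    HasSum (besselTerm (-((n : ℝ) + 1 / 2)) t)
      ((t / 2) ^ (-1 / 2 : ℝ) / √Real.pi *
        ((-1) ^ (n + 1) * riccati Real.sin (-Real.cos) (n + 1) t)) := by
  induction n with
  | zero =>
    constructor
    · convert hasSum_besselTerm_half ht using 2
      · norm_num
      · rw [riccati]; simp
    · convert hasSum_besselTerm_neg_half ht using 2
      · norm_num
      · rw [riccati]; simp
  | succ n ih =>
    have hν : ∀ m : ℤ, -((n : ℝ) + 1 / 2) ≠ m := fun m h =>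
      nat_add_half_ne_int n (-m) (by push_cast; linarith)
    refine ⟨?_, ?_⟩
    · convert ih.2 using 2
      push_cast; ring
    · convert hasSum_besselTerm_sub_one hν ht ih.2 ih.1 using 1
      · congr 1; push_cast; ring
      · rw [riccati_add_two]; ring

lemma sqrt_mul_rpow_neg_half {t : ℝ} (ht : 0 < t) :
    √(Real.pi / (2 * t)) * ((t / 2) ^ (-1 / 2 : ℝ) / √Real.pi) = 1 / t := by
  have hx : 0 < t / 2 := by positivity
  rw [show (-1 / 2 : ℝ) = -(1 / 2) by ring, Real.rpow_neg hx.le, ← Real.sqrt_eq_rpow,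
    Real.sqrt_div Real.pi_pos.le]
  have h : √(2 * t) * √(t / 2) = t := by
    rw [← Real.sqrt_mul (by positivity), show 2 * t * (t / 2) = t ^ 2 by ring,
      Real.sqrt_sq ht.le]
  have : √Real.pi ≠ 0 := by positivity
  have : √(2 * t) ≠ 0 := by positivity
  have : √(t / 2) ≠ 0 := by positivity
  field_simp
  linarith

lemma sphJ_eq_riccati {t : ℝ} (ht : 0 < t) (n : ℕ) :
    sphJ n t = riccati Real.cos Real.sin (n + 1) t / t := by
  have h : besselJ ((n : ℝ) + 1 / 2) t = _ := (hasSum_besselTerm_nat_add_half ht n).2.tsum_eq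
  rw [sphJ, h, ← mul_assoc, sqrt_mul_rpow_neg_half ht]
  ring

lemma sphY_eq_riccati {t : ℝ} (ht : 0 < t) (n : ℕ) :
    sphY n t = riccati Real.sin (-Real.cos) (n + 1) t / t := by
  have h : besselJ (-((n : ℝ) + 1 / 2)) t = _ :=
    (hasSum_besselTerm_neg_nat_add_half ht n).2.tsum_eq
  rw [sphY, h, mul_assoc, ← mul_assoc √_, sqrt_mul_rpow_neg_half ht]
  have : ((-1 : ℝ) ^ (n + 1)) * (-1) ^ (n + 1) = 1 := by rw [← mul_pow]; norm_num
  linear_combination (1 / t * riccati Real.sin (-Real.cos) (n + 1) t) * this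

lemma hasDerivAt_riccati_cos_sin {t : ℝ} (ht : 0 < t) (k : ℕ) :
    HasDerivAt (riccati Real.cos Real.sin k)
      (k / t * riccati Real.cos Real.sin k t - riccati Real.cos Real.sin (k + 1) t) t ∧
    HasDerivAt (riccati Real.cos Real.sin (k + 1))
      (riccati Real.cos Real.sin k t - k / t * riccati Real.cos Real.sin (k + 1) t) t :=
  hasDerivAt_riccati Real.hasDerivAt_cos Real.hasDerivAt_sin ht k

lemma hasDerivAt_riccati_sin_neg_cos {t : ℝ} (ht : 0 < t) (k : ℕ) :
    HasDerivAt (riccati Real.sin (-Real.cos) k)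
      (k / t * riccati Real.sin (-Real.cos) k t - riccati Real.sin (-Real.cos) (k + 1) t) t ∧
    HasDerivAt (riccati Real.sin (-Real.cos) (k + 1))
      (riccati Real.sin (-Real.cos) k t - k / t * riccati Real.sin (-Real.cos) (k + 1) t) t :=
  hasDerivAt_riccati (fun t => by simpa using Real.hasDerivAt_sin t)
    (fun t => by simpa using (Real.hasDerivAt_cos t).neg) ht k

lemma riccati_wronskian {t : ℝ} (k : ℕ) :
    riccati Real.sin (-Real.cos) k t * riccati Real.cos Real.sin (k + 1) t -
      riccati Real.cos Real.sin k t * riccati Real.sin (-Real.cos) (k + 1) t = 1 := by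
  induction k with
  | zero =>
    simp only [riccati, Pi.neg_apply]
    nlinarith [Real.sin_sq_add_cos_sq t]
  | succ k ih =>
    rw [riccati_add_two, riccati_add_two]
    linarith

lemma hasDerivAt_eval_inv (p : Polynomial ℝ) {t : ℝ} (ht : 0 < t) :
    HasDerivAt (fun t : ℝ => p.eval t⁻¹) (-(t⁻¹ ^ 2 * p.derivative.eval t⁻¹)) t := by
  have h := (p.hasDerivAt t⁻¹).comp t (hasDerivAt_inv ht.ne')
  refine h.congr_deriv ?_
  rw [inv_pow]
  ring

lemma eval_map_nonneg (p : Polynomial NNReal) {x : ℝ} (hx : 0 ≤ x) :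
    0 ≤ (p.map NNReal.toRealHom).eval x := by
  rw [Polynomial.eval_map, Polynomial.eval₂_eq_sum_range]
  exact Finset.sum_nonneg fun i _ => mul_nonneg (p.coeff i).2 (pow_nonneg hx i)

open Polynomial in
/-- The modulus of the Riccati-Hankel function is a polynomial in `1 / t` with nonnegative
coefficients. -/
lemma exists_polynomial_riccati_sq (k : ℕ) : ∃ p : Polynomial NNReal, ∀ t : ℝ, 0 < t →
    riccati Real.cos Real.sin k t ^ 2 + riccati Real.sin (-Real.cos) k t ^ 2 =
      (p.map NNReal.toRealHom).eval t⁻¹ := by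
  induction k with
  | zero => exact ⟨1, fun t _ => by simp [riccati]⟩
  | succ k ih =>
    obtain ⟨p, hp⟩ := ih
    set c : Polynomial NNReal := C (k : NNReal) * X * p + C (1 / 2) * X ^ 2 * derivative p with hc
    have hC : ∀ t : ℝ, 0 < t →
        riccati Real.cos Real.sin k t * riccati Real.cos Real.sin (k + 1) t +
        riccati Real.sin (-Real.cos) k t * riccati Real.sin (-Real.cos) (k + 1) t =
        (c.map NNReal.toRealHom).eval t⁻¹ := by
      intro t ht
      have h1 := ((hasDerivAt_riccati_cos_sin ht k).1.pow 2).add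
        ((hasDerivAt_riccati_sin_neg_cos ht k).1.pow 2)
      have h2 := (hasDerivAt_eval_inv (p.map NNReal.toRealHom) ht).congr_of_eventuallyEq
        ((eventually_gt_nhds ht).mono fun s hs => hp s hs)
      have h := h1.unique h2
      have hpt := hp t ht
      simp only [hc, Polynomial.map_add, Polynomial.map_mul, Polynomial.map_pow, map_C, map_X,
        eval_add, eval_mul, eval_pow, eval_C, eval_X, derivative_map] at h ⊢
      simp only [NNReal.coe_toRealHom, NNReal.coe_natCast, NNReal.coe_div, NNReal.coe_one,
        NNReal.coe_ofNat, ← hpt] at h ⊢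
      push_cast at h
      linear_combination (-1 / 2) * h
    refine ⟨p + X ^ 2 * derivative c, fun t ht => ?_⟩
    obtain ⟨a0, a1⟩ := hasDerivAt_riccati_cos_sin ht k
    obtain ⟨b0, b1⟩ := hasDerivAt_riccati_sin_neg_cos ht k
    have h1 := (a0.mul a1).add (b0.mul b1)
    have h2 := (hasDerivAt_eval_inv (c.map NNReal.toRealHom) ht).congr_of_eventuallyEq
      ((eventually_gt_nhds ht).mono fun s hs => hC s hs)
    have h := h1.unique h2
    have hpt := hp t ht
    simp only [Polynomial.map_add, Polynomial.map_mul, Polynomial.map_pow, map_X,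
      eval_add, eval_mul, eval_pow, eval_X, derivative_map, ← hpt] at h ⊢
    linear_combination -h

lemma ofReal_mul_div_add_I_mul_re (z a b c d : ℝ) :
    ((z : ℂ) * ((a : ℂ) + Complex.I * b) / ((c : ℂ) + Complex.I * d)).re =
      z * (a * c + b * d) / (c ^ 2 + d ^ 2) := by
  simp [Complex.div_re, Complex.normSq_apply]
  ring

lemma ofReal_mul_div_add_I_mul_im (z a b c d : ℝ) :
    ((z : ℂ) * ((a : ℂ) + Complex.I * b) / ((c : ℂ) + Complex.I * d)).im =
      z * (b * c - a * d) / (c ^ 2 + d ^ 2) := by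
  simp [Complex.div_im, Complex.normSq_apply]
  ring

/-- For all `z > 0` and all `n`, `Re Θ_n(z) ≤ -1/2` and `Im Θ_n(z) > 0`. -/
theorem Theta_re_im (z : ℝ) (hz : 0 < z) (n : ℕ) :
    (Theta n z).re ≤ -1 / 2 ∧ 0 < (Theta n z).im := by
  obtain ⟨p, hp⟩ := exists_polynomial_riccati_sq (n + 1)
  obtain ⟨-, a1⟩ := hasDerivAt_riccati_cos_sin hz n
  obtain ⟨-, b1⟩ := hasDerivAt_riccati_sin_neg_cos hz n
  have hW := riccati_wronskian (t := z) n
  have hmono := ((a1.pow 2).add (b1.pow 2)).unique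
    ((hasDerivAt_eval_inv (p.map NNReal.toRealHom) hz).congr_of_eventuallyEq
      ((eventually_gt_nhds hz).mono fun s hs => hp s hs))
  have hnn : 0 ≤ z⁻¹ ^ 2 * (p.map NNReal.toRealHom).derivative.eval z⁻¹ := by
    rw [Polynomial.derivative_map]
    exact mul_nonneg (by positivity) (eval_map_nonneg _ (by positivity))
  have hd : HasDerivAt (sphH1 n) _ z :=
    (((a1.div (hasDerivAt_id z) hz.ne').ofReal_comp).add
      (((b1.div (hasDerivAt_id z) hz.ne').ofReal_comp).const_mul
        Complex.I)).congr_of_eventuallyEq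
      ((eventually_gt_nhds hz).mono fun s hs => by
        simp [sphH1, sphJ_eq_riccati hs, sphY_eq_riccati hs])
  rw [Theta, hd.deriv, sphH1, sphJ_eq_riccati hz, sphY_eq_riccati hz]
  rw [ofReal_mul_div_add_I_mul_re, ofReal_mul_div_add_I_mul_im]
  simp only [id]
  generalize riccati Real.cos Real.sin (n + 1) z = R at *
  generalize riccati Real.sin (-Real.cos) (n + 1) z = S at *
  generalize riccati Real.cos Real.sin n z = R' at *
  generalize riccati Real.sin (-Real.cos) n z = S' at *
  have hV : 0 < R ^ 2 + S ^ 2 := by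
    rcases eq_or_ne R 0 with rfl | hR
    · have : S ≠ 0 := by rintro rfl; simp at hW
      positivity
    · positivity
  constructor
  · have hle : R * (R' - n / z * R) + S * (S' - n / z * S) ≤ 0 := by
      simp only [Nat.cast_ofNat, Nat.add_one_sub_one, pow_one] at hmono
      linarith
    have he : z * (((R' - n / z * R) * z - R * 1) / z ^ 2 * (R / z) +
        ((S' - n / z * S) * z - S * 1) / z ^ 2 * (S / z)) / ((R / z) ^ 2 + (S / z) ^ 2) =
        z * (R * (R' - n / z * R) + S * (S' - n / z * S)) / (R ^ 2 + S ^ 2) - 1 := by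
      field_simp
      ring
    rw [he]
    have : z * (R * (R' - n / z * R) + S * (S' - n / z * S)) / (R ^ 2 + S ^ 2) ≤ 0 :=
      div_nonpos_of_nonpos_of_nonneg (mul_nonpos_of_nonneg_of_nonpos hz.le hle) hV.le
    linarith
  · have he : z * (((S' - n / z * S) * z - S * 1) / z ^ 2 * (R / z) -
        ((R' - n / z * R) * z - R * 1) / z ^ 2 * (S / z)) / ((R / z) ^ 2 + (S / z) ^ 2) =
        z * (S' * R - R' * S) / (R ^ 2 + S ^ 2) := by
      field_simp
      ring
    rw [he, hW]
    positivity
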